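/- arXiv:2506.13489 — 2 statements merged into one kernel-verified Lean document; each statement's English description precedes it below -/
import Mathlib

section
/- There is an absolute constant c₀ such that the following holds for all c ≥ c₀. Let n ≥ 2, let α ∈ (0,1], ε > 0, and let k ≥ 2 be an integer with e^{−k} < α, let L ≥ ln n be a positive integer, and suppose m1 := (c/64)k² and m2 := (c/α^{2+ε})k² are positive integers. Let (X_r) for m1·L ≤ r < (m2+1)·L be independent {0,1}-valued random variables with P(X_r = 1) = p(r) = 1/√(⌊r/L⌋+1), and let Y⊥ = ∑_{r=m1·L}^{(m2+1)·L − 1} X_r. Then P(Y⊥ < (7/10)·(1/α^{1+ε/2} − 1/8)·√c·k·L) < (1/c²)·n^{−8·ln(4/α)}. -/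
open MeasureTheory

/-- Probability of a one at position `r` in the random matrix construction with block
length `L`: `p(r) = 1/√(⌊r/L⌋+1)` (natural-number division is floor division). -/
noncomputable def pval (L r : ℕ) : ℝ := 1 / Real.sqrt (((r / L : ℕ) : ℝ) + 1)

/-- The Bernoulli measure on `Bool` with parameter `p`. -/
noncomputable def bern (p : ℝ) : Measure Bool :=
  ENNReal.ofReal p • Measure.dirac true + ENNReal.ofReal (1 - p) • Measure.dirac false

instance isFiniteMeasure_bern (p : ℝ) : IsFiniteMeasure (bern p) := by
  refine ⟨?_⟩
  simp [bern]

theorem integral_bern {p : ℝ} (h0 : 0 ≤ p) (h1 : p ≤ 1) (f : Bool → ℝ) :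
    ∫ b, f b ∂(bern p) = p * f true + (1 - p) * f false := by
  have hint (b : Bool) (x : ℝ) : Integrable f (ENNReal.ofReal x • Measure.dirac b) :=
    Integrable.of_finite.smul_measure ENNReal.ofReal_ne_top
  rw [bern, integral_add_measure (hint _ _) (hint _ _),
    integral_smul_measure, integral_smul_measure, integral_dirac, integral_dirac,
    ENNReal.toReal_ofReal h0, ENNReal.toReal_ofReal (sub_nonneg.2 h1)]
  simp

theorem exp_neg_one_le : Real.exp (-1) ≤ 2 / 5 := by
  rw [Real.exp_neg, inv_le_comm₀ (Real.exp_pos _) (by norm_num)]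
  linarith [Real.exp_one_gt_d9]

/-- Lower-tail Chernoff bound, at exponential parameter `-1`, for a sum of independent
Bernoulli variables over the coordinates satisfying `P`. -/
theorem bern_lower_tail {ι : Type*} [Fintype ι] (p : ι → ℝ) (h0 : ∀ i, 0 ≤ p i)
    (h1 : ∀ i, p i ≤ 1) (P : ι → Prop) [DecidablePred P] (t : ℝ) :
    (Measure.pi fun i => bern (p i)).real
        {ω : ι → Bool | (∑ i, (if P i ∧ ω i = true then (1 : ℝ) else 0)) ≤ t} ≤
      Real.exp (t - 3 / 5 * ∑ i, if P i then p i else 0) := by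
  refine (ProbabilityTheory.measure_le_le_exp_mul_mgf (t := -1)
    (X := fun ω : ι → Bool => ∑ i, (if P i ∧ ω i = true then (1 : ℝ) else 0))
    t (by norm_num) Integrable.of_finite).trans ?_
  rw [sub_eq_add_neg, Real.exp_add, neg_neg, one_mul, Finset.mul_sum, ← Finset.sum_neg_distrib,
    Real.exp_sum]
  refine mul_le_mul_of_nonneg_left ?_ (Real.exp_pos _).le
  simp only [ProbabilityTheory.mgf, Finset.mul_sum, Real.exp_sum]
  rw [integral_fintype_prod_eq_prod
    (f := fun i b => Real.exp (-1 * (if P i ∧ b = true then (1 : ℝ) else 0)))]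
  refine Finset.prod_le_prod (fun i _ => integral_nonneg fun b => (Real.exp_pos _).le)
    fun i _ => ?_
  rw [integral_bern (h0 i) (h1 i)]
  by_cases hi : P i
  · simp only [hi, true_and, if_true, mul_one, Bool.false_eq_true, if_false, mul_zero,
      Real.exp_zero]
    have := Real.add_one_le_exp (-(3 / 5 * p i))
    nlinarith [mul_le_mul_of_nonneg_left exp_neg_one_le (h0 i)]
  · simp [hi]

theorem sum_range_mul_div (F : ℕ → ℝ) (M : ℕ) {L : ℕ} (hL : 0 < L) :
    ∑ r ∈ Finset.range (M * L), F (r / L) = L * ∑ b ∈ Finset.range M, F b := by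
  induction M with
  | zero => simp
  | succ M ih =>
    have h : ∀ x ∈ Finset.range L, F ((M * L + x) / L) = F M := fun x hx => by
      rw [mul_comm M L, Nat.mul_add_div hL, Nat.div_eq_of_lt (Finset.mem_range.1 hx), add_zero]
    rw [add_mul, one_mul, Finset.sum_range_add, ih, Finset.sum_range_succ,
      Finset.sum_congr rfl h]
    simp [mul_add]

theorem two_mul_sqrt_sub_sqrt_le (x : ℝ) (hx : 0 < x) :
    2 * (√(x + 1) - √x) ≤ 1 / √x := by
  have hs := Real.sqrt_pos.2 hx
  rw [le_div_iff₀ hs]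
  nlinarith [sq_nonneg (√(x + 1) - √x), Real.sq_sqrt hx.le,
    Real.sq_sqrt (by linarith : (0 : ℝ) ≤ x + 1)]

theorem le_sum_one_div_sqrt {m M : ℕ} (h : m ≤ M) :
    2 * (√(M + 1 : ℝ) - √(m + 1 : ℝ)) ≤
      ∑ b ∈ Finset.range M, if m ≤ b then 1 / √((b : ℝ) + 1) else 0 := by
  induction M, h using Nat.le_induction with
  | base =>
    rw [sub_self, mul_zero]
    exact Finset.sum_nonneg fun b _ => by positivity
  | succ M hM ih =>
    rw [Finset.sum_range_succ, if_pos hM]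
    have := two_mul_sqrt_sub_sqrt_le ((M : ℝ) + 1) (by positivity)
    push_cast
    linarith

theorem le_sum_pval {m M L : ℕ} (h : m ≤ M) (hL : 0 < L) :
    L * (2 * (√(M + 1 : ℝ) - √(m + 1 : ℝ))) ≤
      ∑ r : Fin (M * L), if m * L ≤ r.val then pval L r.val else 0 := by
  rw [Fin.sum_univ_eq_sum_range (fun r => if m * L ≤ r then pval L r else 0) (M * L)]
  simp only [pval, ← Nat.le_div_iff_mul_le hL]
  rw [sum_range_mul_div (fun b => if m ≤ b then 1 / √((b : ℝ) + 1) else 0) M hL]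
  exact mul_le_mul_of_nonneg_left (le_sum_one_div_sqrt h) (Nat.cast_nonneg _)

theorem pval_nonneg (L r : ℕ) : 0 ≤ pval L r := by
  unfold pval; positivity

theorem pval_le_one (L r : ℕ) : pval L r ≤ 1 := by
  unfold pval
  refine div_le_one_of_le₀ ?_ (Real.sqrt_nonneg _)
  rw [Real.one_le_sqrt]
  linarith [(Nat.cast_nonneg (r / L) : (0 : ℝ) ≤ ((r / L : ℕ) : ℝ))]

theorem log_four_div_le {α : ℝ} (h0 : 0 < α) {k : ℕ} (hk : 2 ≤ k)
    (hα : Real.exp (-(k : ℝ)) < α) : Real.log (4 / α) ≤ 2 * k := by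
  have h4 : Real.log 4 ≤ 2 := by
    rw [show (4 : ℝ) = 2 ^ 2 by norm_num, Real.log_pow]
    have := Real.log_two_lt_d9
    push_cast
    linarith
  have h := (Real.lt_log_iff_exp_lt h0).2 hα
  have hk' : (2 : ℝ) ≤ k := by exact_mod_cast hk
  rw [Real.log_div (by norm_num) h0.ne']
  linarith

theorem log_le_four_mul_sqrt_sqrt {c : ℝ} (hc : 0 < c) : Real.log c ≤ 4 * √(√c) := by
  have h := Real.log_le_sub_one_of_pos (Real.sqrt_pos.2 (Real.sqrt_pos.2 hc))
  rw [Real.log_sqrt (Real.sqrt_nonneg _), Real.log_sqrt hc.le] at h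
  linarith

theorem sq_rpow_eq {α ε : ℝ} (h0 : 0 < α) :
    (α ^ ((1 : ℝ) + ε / 2)) ^ 2 = α ^ ((2 : ℝ) + ε) := by
  rw [← Real.rpow_natCast, ← Real.rpow_mul h0.le]
  congr 1
  push_cast
  ring

/-- The numerical estimate: for large `c` the Chernoff exponent beats the target bound. -/
theorem two_log_add_lt {c K L a A : ℝ} (hc : 10 ^ 6 ≤ c) (hK : 2 ≤ K) (hL : 1 ≤ L)
    (ha : 1 ≤ a) (hA : A ≤ 16 * K * L) :
    2 * Real.log c + A < 2 / 5 * ((a - 1 / 8) * √c * K * L) := by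
  have hq := log_le_four_mul_sqrt_sqrt (by linarith : 0 < c)
  set q := √(√c)
  have hq2 : q ^ 2 = √c := Real.sq_sqrt (Real.sqrt_nonneg _)
  have hc3 : 1000 ≤ √c := Real.le_sqrt_of_sq_le (by linarith)
  have hq30 : 30 ≤ q := Real.le_sqrt_of_sq_le (by linarith)
  have hKL : 2 ≤ K * L := by nlinarith
  have h1 : 7 / 8 * (√c * (K * L)) ≤ (a - 1 / 8) * (√c * (K * L)) :=
    mul_le_mul_of_nonneg_right (by linarith) (by positivity)
  have h2 : 1000 * (K * L) ≤ √c * (K * L) :=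
    mul_le_mul_of_nonneg_right hc3 (by positivity)
  have h3 : √c * 2 ≤ √c * (K * L) := mul_le_mul_of_nonneg_left hKL (by positivity)
  have h4 : 30 * q ≤ √c := by nlinarith
  nlinarith

/-- Chernoff-type lower-tail bound on the weight `Y⊥` of the lower segment
`[m1·L, (m2+1)·L)` of a random column: there is an absolute constant `c₀` such that
for all `c ≥ c₀`, `P(Y⊥ < (7/10)·(1/α^{1+ε/2} − 1/8)·√c·k·L) < (1/c²)·n^{−8·ln(4/α)}`,
where the coordinates are independent Bernoulli(`p(r)`) variables. -/
theorem stmt12 :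
    ∃ c₀ : ℝ, ∀ c : ℝ, c₀ ≤ c →
      ∀ n : ℕ, 2 ≤ n → ∀ α ε : ℝ, 0 < α → α ≤ 1 → 0 < ε →
        ∀ k : ℕ, 2 ≤ k → Real.exp (-(k : ℝ)) < α →
          ∀ L : ℕ, 0 < L → Real.log n ≤ (L : ℝ) →
            ∀ m1 m2 : ℕ, 0 < m1 → 0 < m2 →
              (m1 : ℝ) = c / 64 * (k : ℝ) ^ 2 →
              (m2 : ℝ) = c / α ^ ((2 : ℝ) + ε) * (k : ℝ) ^ 2 →
              (Measure.pi fun r : Fin ((m2 + 1) * L) => bern (pval L r.val))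
                  {ω : Fin ((m2 + 1) * L) → Bool |
                    (∑ r : Fin ((m2 + 1) * L),
                        (if m1 * L ≤ r.val ∧ ω r = true then (1 : ℝ) else 0))
                      < 7 / 10 * (1 / α ^ ((1 : ℝ) + ε / 2) - 1 / 8) *
                          Real.sqrt c * (k : ℝ) * (L : ℝ)}
                < ENNReal.ofReal
                    (1 / c ^ 2 * (n : ℝ) ^ (-(8 * Real.log (4 / α)))) := by
  refine ⟨10 ^ 6, fun c hc n hn α ε hα hα1 hε k hk hkα L hL hnL m1 m2 hm1 hm2 h1 h2 => ?_⟩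
  have hc0 : 0 < c := by linarith
  have hn0 : (0 : ℝ) < n := by exact_mod_cast (by omega : 0 < n)
  have hk2 : (2 : ℝ) ≤ k := by exact_mod_cast hk
  have hL1 : (1 : ℝ) ≤ L := by exact_mod_cast hL
  have hd0 : 0 < α ^ ((1 : ℝ) + ε / 2) := Real.rpow_pos_of_pos hα _
  have hd1 : α ^ ((1 : ℝ) + ε / 2) ≤ 1 := Real.rpow_le_one hα.le hα1 (by linarith)
  rw [← sq_rpow_eq hα] at h2
  set a := 1 / α ^ ((1 : ℝ) + ε / 2) with hadef
  have ha1 : 1 ≤ a := by rwa [hadef, le_div_iff₀ hd0, one_mul]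
  have hc3 : 1000 ≤ √c := Real.le_sqrt_of_sq_le (by linarith)
  have hsq : √c ^ 2 = c := Real.sq_sqrt hc0.le
  have h2' : (m2 : ℝ) = (a * √c * k) ^ 2 := by
    rw [h2, mul_pow, mul_pow, hsq, hadef]
    ring
  have h1' : (m1 : ℝ) = (√c * k / 8) ^ 2 := by
    rw [h1, div_pow, mul_pow, hsq]
    ring
  have hck : 2000 ≤ √c * k := by nlinarith
  have hs1 : √((m1 : ℝ) + 1) ≤ √c * k / 8 + 1 :=
    Real.sqrt_le_iff.2 ⟨by positivity, by rw [h1']; nlinarith⟩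
  have hs2 : a * √c * k ≤ √(((m2 + 1 : ℕ) : ℝ) + 1) := by
    refine Real.le_sqrt_of_sq_le ?_
    push_cast
    linarith
  have hack : √c * k ≤ a * (√c * k) := le_mul_of_one_le_left (by positivity) ha1
  have hm : m1 ≤ m2 + 1 := by
    have : (m1 : ℝ) ≤ m2 := by
      rw [h1', h2']
      exact pow_le_pow_left₀ (by positivity) (by linarith) 2
    exact (Nat.cast_le.1 this).trans (Nat.le_succ _)
  have hmean := le_sum_pval hm hL
  set D := (a - 1 / 8) * √c * k * L with hD
  have hmean' : 19 / 10 * D ≤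
      ∑ r : Fin ((m2 + 1) * L), if m1 * L ≤ r.val then pval L r.val else 0 := by
    refine le_trans ?_ hmean
    rw [hD, mul_comm _ (L : ℝ), mul_left_comm]
    refine mul_le_mul_of_nonneg_left ?_ (by positivity)
    linarith
  have htail := bern_lower_tail (fun r : Fin ((m2 + 1) * L) => pval L r.val)
    (fun r => pval_nonneg _ _) (fun r => pval_le_one _ _) (fun r => m1 * L ≤ r.val)
    (7 / 10 * D)
  have hA : 8 * Real.log (4 / α) * Real.log n ≤ 16 * k * L := by
    have hl := log_four_div_le hα hk hkα
    have hn' := Real.log_natCast_nonneg n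
    calc 8 * Real.log (4 / α) * Real.log n ≤ 8 * (2 * k) * Real.log n := by gcongr
      _ ≤ 8 * (2 * k) * L := by gcongr
      _ = 16 * k * L := by ring
  have hnum := two_log_add_lt hc hk2 hL1 ha1 hA
  rw [← hD] at hnum
  have hD0 : 0 ≤ D := by
    have : 0 ≤ a - 1 / 8 := by linarith
    positivity
  have htarget : 1 / c ^ 2 * (n : ℝ) ^ (-(8 * Real.log (4 / α))) =
      Real.exp (-(2 * Real.log c + 8 * Real.log (4 / α) * Real.log n)) := by
    rw [Real.rpow_def_of_pos hn0, neg_add, Real.exp_add, Real.exp_neg (2 * _),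
      two_mul (Real.log c), Real.exp_add, Real.exp_log hc0]
    congr 2
    · ring
    · ring
  have hset : 7 / 10 * (a - 1 / 8) * √c * k * L = 7 / 10 * D := by rw [hD]; ring
  simp only [hset]
  refine (ENNReal.lt_ofReal_iff_toReal_lt (measure_ne_top _ _)).2 ?_
  rw [htarget]
  refine (measureReal_mono (Set.ofPred_subset_ofPred.2 fun ω hω => le_of_lt hω)).trans_lt
    (htail.trans_lt ?_)
  rw [Real.exp_lt_exp]
  linarith
end

section
/- For every ε > 0 there exists a constant C > 0 such that for every integer n ≥ 2 and every real α ∈ (0,1], there exists a t×n binary matrix M with t = ⌈(C/α^{2+ε})·n²·ln n⌉ rows such that for every integer k with 2 ≤ k ≤ n and e^{−k} < α, every subset T of k column indices of M, every c_j ∈ T, and every z ∈ S∨(T∖{c_j}), one has |([c_j] ∧ z*)_{[0, τ(n,k)]}| < α · |[c_j]_{[0, τ(n,k)]}|, where τ(n,k) = ⌈(C/α^{2+ε})·k²·ln n⌉. -/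
/-- The `i`-th cyclic shift (positions read mod `t`) of a binary vector of length `t`. -/
def cshift (t : ℕ) (x : ℕ → Bool) (i : ℤ) : ℕ → Bool :=
  fun r => x ((((r : ℤ) + i) % (t : ℤ)).toNat)

/-- The weight (number of ones) of `x` on bit positions in `[a, b]`. -/
def wt (x : ℕ → Bool) (a b : ℕ) : ℕ :=
  ((Finset.Icc a b).filter fun r => x r = true).card

/-- Bitwise AND of two binary vectors. -/
def vand (x y : ℕ → Bool) : ℕ → Bool := fun r => x r && y r

/-- The slipped vector `z* = z(−1) ∨ z ∨ z(1)`. -/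
def slip (t : ℕ) (z : ℕ → Bool) : ℕ → Bool :=
  fun r => cshift t z (-1) r || z r || cshift t z 1 r

/-- `z ∈ S∨(R)`, where `R` is the family of columns of `M` indexed by `T`: `z` is the
bitwise OR of one cyclic shift of each vector in `R`. -/
def memSupShift (t : ℕ) {n : ℕ} (M : Fin n → ℕ → Bool) (T : Finset (Fin n))
    (z : ℕ → Bool) : Prop :=
  ∃ σ : Fin n → ℤ, ∀ r : ℕ, z r = true ↔ ∃ j ∈ T, cshift t (M j) (σ j) r = true

open Finset

/-- The probability of `ω ⊆ U` when each `i ∈ U` is selected independently with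
probability `p i`. -/
def bernoulliWeight {ι : Type*} [DecidableEq ι] (U : Finset ι) (p : ι → ℝ) (ω : Finset ι) : ℝ :=
  (∏ i ∈ ω, p i) * ∏ i ∈ U \ ω, (1 - p i)

lemma bernoulliWeight_nonneg {ι : Type*} [DecidableEq ι] {U : Finset ι} {p : ι → ℝ}
    (h0 : ∀ i, 0 ≤ p i) (h1 : ∀ i, p i ≤ 1) (ω : Finset ι) : 0 ≤ bernoulliWeight U p ω :=
  mul_nonneg (prod_nonneg fun i _ => h0 i) (prod_nonneg fun i _ => sub_nonneg.2 (h1 i))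

lemma sum_bernoulliWeight_superset {ι : Type*} [DecidableEq ι] {U I : Finset ι} (p : ι → ℝ)
    (hI : I ⊆ U) :
    ∑ ω ∈ U.powerset, bernoulliWeight U p ω * (if I ⊆ ω then 1 else 0) = ∏ i ∈ I, p i := by
  have h := prod_add p (fun i => if i ∈ I then 0 else 1 - p i) U
  have h2 : ∏ i ∈ U, (p i + if i ∈ I then 0 else 1 - p i) = ∏ i ∈ I, p i := by
    rw [← prod_subset hI (f := fun i => p i + if i ∈ I then 0 else 1 - p i)]
    · exact prod_congr rfl fun i hi => by simp [hi]
    · intro i _ hi; simp [hi]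
  rw [← h2, h]
  refine sum_congr rfl fun ω _ => ?_
  unfold bernoulliWeight
  by_cases hs : I ⊆ ω
  · rw [if_pos hs, mul_one]
    congr 1
    refine prod_congr rfl fun i hi => ?_
    rw [if_neg fun h => (mem_sdiff.1 hi).2 (hs h)]
  · rw [if_neg hs, mul_zero]
    obtain ⟨i, hi, hn⟩ := not_subset.1 hs
    rw [prod_eq_zero (i := i) (s := U \ ω) (mem_sdiff.2 ⟨hI hi, hn⟩) (by simp [hi]), mul_zero]

/-- The moment generating function of the number of the disjoint sets `I r`, `r ∈ S`, that are
contained in a random subset. -/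
lemma sum_bernoulliWeight_exp {ι κ : Type*} [DecidableEq ι] {U : Finset ι}
    (p : ι → ℝ) (c : ℝ) (S : Finset κ) (I : κ → Finset ι) (hI : ∀ r ∈ S, I r ⊆ U)
    (hd : (S : Set κ).PairwiseDisjoint I) :
    ∑ ω ∈ U.powerset, bernoulliWeight U p ω * Real.exp (c * #{r ∈ S | I r ⊆ ω}) =
      ∏ r ∈ S, (1 + (Real.exp c - 1) * ∏ i ∈ I r, p i) := by
  classical
  have h1 : ∀ ω : Finset ι, Real.exp (c * #{r ∈ S | I r ⊆ ω}) =
      ∑ R ∈ S.powerset, (Real.exp c - 1) ^ #R * (if R.biUnion I ⊆ ω then 1 else 0) := by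
    intro ω
    have : Real.exp (c * #{r ∈ S | I r ⊆ ω}) =
        ∏ r ∈ S, (1 + (Real.exp c - 1) * (if I r ⊆ ω then 1 else 0)) := by
      rw [mul_comm, Real.exp_nat_mul, ← prod_const, prod_filter]
      refine prod_congr rfl fun r _ => ?_
      split_ifs <;> simp
    rw [this, prod_one_add]
    refine sum_congr rfl fun R _ => ?_
    rw [prod_mul_distrib, prod_const]
    congr 1
    simp only [biUnion_subset]
    split_ifs with h
    · exact prod_eq_one fun r hr => by simp [h r hr]
    · push Not at h
      obtain ⟨r, hr, hn⟩ := h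
      exact prod_eq_zero hr (by simp [hn])
  simp_rw [h1, mul_sum]
  rw [sum_comm, prod_one_add]
  refine sum_congr rfl fun R hR => ?_
  have hRS := mem_powerset.1 hR
  rw [prod_mul_distrib, prod_const, ← prod_biUnion (hd.subset (by exact_mod_cast hRS)),
    ← sum_bernoulliWeight_superset p (biUnion_subset.2 fun r hr => hI r (hRS hr)), mul_sum]
  exact sum_congr rfl fun ω _ => by ring

lemma sum_bernoulliWeight_exp_le {ι κ : Type*} [DecidableEq ι] {U : Finset ι}
    {p : ι → ℝ} (h0 : ∀ i, 0 ≤ p i) (h1 : ∀ i, p i ≤ 1) (c m : ℝ)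
    {S : Finset κ} {I : κ → Finset ι} (hI : ∀ r ∈ S, I r ⊆ U)
    (hd : (S : Set κ).PairwiseDisjoint I) :
    ∑ ω ∈ U.powerset, bernoulliWeight U p ω * Real.exp (c * #{r ∈ S | I r ⊆ ω} + m) ≤
      Real.exp ((Real.exp c - 1) * ∑ r ∈ S, ∏ i ∈ I r, p i + m) := by
  simp_rw [Real.exp_add, ← mul_assoc, ← sum_mul]
  rw [sum_bernoulliWeight_exp p c S I hI hd, mul_sum, Real.exp_sum]
  gcongr with r hr
  · intro r _
    have hp0 : 0 ≤ ∏ i ∈ I r, p i := prod_nonneg fun i _ => h0 i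
    have hp1 : ∏ i ∈ I r, p i ≤ 1 := prod_le_one (fun i _ => h0 i) fun i _ => h1 i
    nlinarith [Real.exp_pos c]
  · rw [add_comm]; exact Real.add_one_le_exp _

/-- The union bound in the form of a first moment argument. -/
lemma exists_subset_forall_lt_one {ι E : Type*} [DecidableEq ι] [Fintype E] {U : Finset ι}
    {p : ι → ℝ} (h0 : ∀ i, 0 ≤ p i) (h1 : ∀ i, p i ≤ 1) (F : E → Finset ι → ℝ)
    (hF : ∀ e ω, 0 ≤ F e ω) (q : ℝ)
    (hq : ∀ e, ∑ ω ∈ U.powerset, bernoulliWeight U p ω * F e ω ≤ q)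
    (hE : Fintype.card E * q < 1) : ∃ ω ⊆ U, ∀ e, F e ω < 1 := by
  by_contra! hcon
  have hsum : ∑ ω ∈ U.powerset, bernoulliWeight U p ω = 1 := by
    simpa using sum_bernoulliWeight_superset p (empty_subset U)
  have : (1 : ℝ) ≤ ∑ e, ∑ ω ∈ U.powerset, bernoulliWeight U p ω * F e ω := by
    rw [sum_comm, ← hsum]
    refine sum_le_sum fun ω hω => ?_
    obtain ⟨e, he⟩ := hcon ω (mem_powerset.1 hω)
    rw [← mul_sum]
    refine le_mul_of_one_le_right (bernoulliWeight_nonneg h0 h1 ω) ?_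
    exact he.trans (single_le_sum (f := fun e => F e ω) (fun e _ => hF e ω) (mem_univ e))
  have h3 := this.trans (sum_le_sum fun e _ => hq e)
  simp at h3
  linarith

lemma sum_range_inv_sqrt_le (a : ℕ) : ∑ r ∈ range a, 1 / √((r : ℝ) + 1) ≤ 2 * √a := by
  induction a with
  | zero => simp
  | succ a ih =>
    rw [sum_range_succ]
    push_cast
    have h1 : (0 : ℝ) < √((a : ℝ) + 1) := by positivity
    have h2 := Real.sqrt_nonneg (a : ℝ)
    have h3 := Real.sq_sqrt (show (0 : ℝ) ≤ (a : ℝ) + 1 by positivity)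
    have h4 := Real.sq_sqrt (show (0 : ℝ) ≤ (a : ℝ) by positivity)
    have : 1 / √((a : ℝ) + 1) ≤ 2 * √((a : ℝ) + 1) - 2 * √a := by
      rw [div_le_iff₀ h1]
      nlinarith [sq_nonneg (√((a : ℝ) + 1) - √a)]
    linarith

lemma sum_Ico_inv_le_log {a b : ℕ} (ha : 0 < a) (hab : a ≤ b) :
    ∑ r ∈ Ico a b, 1 / ((r : ℝ) + 1) ≤ Real.log (b / a) := by
  have ha' : (0 : ℝ) < a := by exact_mod_cast ha
  induction b, hab using Nat.le_induction with
  | base => simp [ha'.ne']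
  | succ b hab ih =>
    have hb : (0 : ℝ) < b := by exact_mod_cast ha.trans_le hab
    rw [sum_Ico_succ_top hab]
    rw [Real.log_div (by positivity) ha'.ne'] at ih ⊢
    have := Real.one_sub_inv_le_log_of_pos (show 0 < ((b : ℝ) + 1) / b by positivity)
    rw [Real.log_div (by positivity) hb.ne'] at this
    have h2 : 1 - (((b : ℝ) + 1) / b)⁻¹ = 1 / ((b : ℝ) + 1) := by field_simp; ring
    push_cast
    linarith

/-- The density of ones at position `r`. -/
noncomputable def density (A : ℝ) (r : ℕ) : ℝ := min 1 (A / √((r : ℝ) + 1))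

lemma density_nonneg {A : ℝ} (hA : 0 ≤ A) (r : ℕ) : 0 ≤ density A r :=
  le_min zero_le_one (by positivity)

lemma density_le_one (A : ℝ) (r : ℕ) : density A r ≤ 1 := min_le_left _ _

lemma density_le (A : ℝ) (r : ℕ) : density A r ≤ A / √((r : ℝ) + 1) := min_le_right _ _

lemma sum_range_density_le {A : ℝ} (hA : 0 ≤ A) (a : ℕ) :
    ∑ r ∈ range a, density A r ≤ 2 * A * √a :=
  calc ∑ r ∈ range a, density A r ≤ ∑ r ∈ range a, A * (1 / √((r : ℝ) + 1)) :=
        sum_le_sum fun r _ => (density_le A r).trans_eq (by ring)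
    _ ≤ A * (2 * √a) := by rw [← mul_sum]; gcongr; exact sum_range_inv_sqrt_le a
    _ = _ := by ring

lemma le_sum_range_density {A : ℝ} (hA : 0 ≤ A) {b : ℕ} (hb : A ≤ √b) :
    A * √b ≤ ∑ r ∈ range b, density A r := by
  rcases Nat.eq_zero_or_pos b with rfl | hpos
  · simp
  have hs : 0 < √(b : ℝ) := by positivity
  have : ∀ r ∈ range b, A / √b ≤ density A r := by
    intro r hr
    refine le_min ((div_le_one hs).2 hb) ?_
    have : (r : ℝ) + 1 ≤ b := by exact_mod_cast mem_range.1 hr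
    gcongr
  refine le_trans ?_ (card_nsmul_le_sum _ _ _ this)
  have hbb := Real.mul_self_sqrt (Nat.cast_nonneg (α := ℝ) b)
  rw [card_range, nsmul_eq_mul]
  nth_rw 2 [← hbb]
  field_simp
  rfl

lemma sum_density_mul_density_le {A : ℝ} (hA : 0 ≤ A) {a b : ℕ} (ha : 0 < a) (hab : a ≤ b)
    {F : Finset ℕ} (hF : F ⊆ Ico a b) {u : ℕ → ℕ} (hu : Set.InjOn u F) :
    ∑ r ∈ F, density A r * density A (u r) ≤ A ^ 2 * (2 * Real.log (b / a) + 2) := by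
  have hlog : ∑ r ∈ Ico a b, A ^ 2 * (1 / ((r : ℝ) + 1)) ≤ A ^ 2 * Real.log (b / a) := by
    rw [← mul_sum]; gcongr; exact sum_Ico_inv_le_log ha hab
  have hsq : ∀ r : ℕ, (A / √((r : ℝ) + 1)) * (A / √((r : ℝ) + 1)) =
      A ^ 2 * (1 / ((r : ℝ) + 1)) := by
    intro r
    rw [div_mul_div_comm, Real.mul_self_sqrt (by positivity)]; ring
  have hanti : ∀ {r s : ℕ}, r ≤ s → density A s ≤ A / √((r : ℝ) + 1) := by
    intro r s hrs
    refine (density_le A s).trans ?_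
    gcongr
  have hnn : ∀ r : ℕ, 0 ≤ A / √((r : ℝ) + 1) := fun r => by positivity
  have hsplit := sum_filter_add_sum_filter_not F (fun r => r ≤ u r)
    (fun r => density A r * density A (u r))
  have h1 : ∑ r ∈ F with r ≤ u r, density A r * density A (u r) ≤ A ^ 2 * Real.log (b / a) := by
    refine le_trans (sum_le_sum (g := fun r : ℕ => A ^ 2 * (1 / ((r : ℝ) + 1))) ?_)
      (le_trans (sum_le_sum_of_subset_of_nonneg ((filter_subset _ _).trans hF) ?_) hlog)
    · intro r hr
      rw [← hsq]
      exact mul_le_mul (density_le A r) (hanti (mem_filter.1 hr).2) (density_nonneg hA _) (hnn r)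
    · intros; positivity
  have h2 : ∑ r ∈ F with ¬ r ≤ u r, density A r * density A (u r) ≤
      A ^ 2 * Real.log (b / a) + 2 * A ^ 2 := by
    let g : ℕ → ℝ := fun v => if v < a then A / √a * (A * (1 / √((v : ℝ) + 1)))
      else A ^ 2 * (1 / ((v : ℝ) + 1))
    have hg0 : ∀ v, 0 ≤ g v := fun v => by simp only [g]; split_ifs <;> positivity
    have hle : ∀ r ∈ F.filter (fun r => ¬ r ≤ u r), density A r * density A (u r) ≤ g (u r) := by
      intro r hr
      obtain ⟨hrF, hru⟩ := mem_filter.1 hr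
      have har := (mem_Ico.1 (hF hrF)).1
      simp only [g]
      split_ifs with hv
      · have : density A r ≤ A / √a := by
          refine (density_le A r).trans ?_
          have : (a : ℝ) ≤ r + 1 := by exact_mod_cast har.trans (Nat.le_succ r)
          gcongr
        refine mul_le_mul this ((density_le A _).trans_eq (by ring)) (density_nonneg hA _)
          (by positivity)
      · rw [← hsq]
        exact mul_le_mul (hanti (by omega)) (density_le A _) (density_nonneg hA _) (hnn _)
    have himg : (F.filter fun r => ¬ r ≤ u r).image u ⊆ range b := by
      intro v hv
      obtain ⟨r, hr, rfl⟩ := mem_image.1 hv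
      obtain ⟨hrF, hru⟩ := mem_filter.1 hr
      have := (mem_Ico.1 (hF hrF)).2
      exact mem_range.2 (by omega)
    refine (sum_le_sum hle).trans ?_
    rw [← sum_image (f := g) (hu.mono (by exact_mod_cast filter_subset _ F))]
    refine (sum_le_sum_of_subset_of_nonneg himg fun v _ _ => hg0 v).trans ?_
    rw [← sum_range_add_sum_Ico g hab, add_comm]
    have e1 : ∑ v ∈ Ico a b, g v = ∑ v ∈ Ico a b, A ^ 2 * (1 / ((v : ℝ) + 1)) :=
      sum_congr rfl fun v hv => if_neg (by simpa using (mem_Ico.1 hv).1)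
    have e2 : ∑ v ∈ range a, g v = A / √a * (A * ∑ v ∈ range a, 1 / √((v : ℝ) + 1)) := by
      rw [mul_sum, mul_sum]
      exact sum_congr rfl fun v hv => if_pos (mem_range.1 hv)
    have hs : 0 < √(a : ℝ) := by positivity
    have e3 : A / √a * (A * ∑ v ∈ range a, 1 / √((v : ℝ) + 1)) ≤ A / √a * (A * (2 * √a)) := by
      gcongr; exact sum_range_inv_sqrt_le a
    have e4 : A / √a * (A * (2 * √(a : ℝ))) = 2 * A ^ 2 := by field_simp
    linarith
  rw [← hsplit]
  linarith

/-- Random columns with independent entries of density `density A` have, in every window, many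
ones, few early ones, and few coincidences with each shift of any other column. -/
lemma exists_columns {n t : ℕ} {A : ℝ} (hA : 0 ≤ A) (τ a : ℕ → ℕ) (lo hi mid : ℕ → ℝ) (Q : ℝ)
    (hτ : ∀ k ∈ Icc 1 n, τ k ≤ t) (ha : ∀ k ∈ Icc 1 n, 0 < a k) (haτ : ∀ k ∈ Icc 1 n, a k ≤ τ k)
    (hlo : ∀ k ∈ Icc 1 n, lo k + Q ≤ 1 / 2 * ∑ r ∈ range (τ k), density A r)
    (hhi : ∀ k ∈ Icc 1 n, 2 * ∑ r ∈ range (a k), density A r + Q ≤ hi k)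
    (hmid : ∀ k ∈ Icc 1 n,
      2 * (A ^ 2 * (2 * Real.log ((τ k + 1 : ℕ) / a k) + 2)) + Q ≤ mid k)
    (hQ : (n * (n * (2 + n * t)) : ℝ) * Real.exp (-Q) < 1) :
    ∃ M : Fin n → ℕ → Bool, (∀ j r, t ≤ r → M j r = false) ∧ ∀ k ∈ Icc 1 n, ∀ j,
      lo k < #{r ∈ range (τ k) | M j r = true} ∧
      #{r ∈ range (a k) | M j r = true} < hi k ∧
      ∀ j' ≠ j, ∀ s < t,
        #{r ∈ {r ∈ Ico (a k) (τ k + 1) | r < t} | M j r = true ∧ M j' ((r + s) % t) = true}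
          < mid k := by
  let U : Finset (Fin n × ℕ) := univ ×ˢ range t
  let p : Fin n × ℕ → ℝ := fun i => density A i.2
  have h0 : ∀ i, 0 ≤ p i := fun i => density_nonneg hA _
  have h1 : ∀ i, p i ≤ 1 := fun i => density_le_one A _
  let S : ℕ → Finset ℕ := fun k => {r ∈ Ico (a k) (τ k + 1) | r < t}
  let P : Fin n → Fin n → ℕ → ℕ → Finset (Fin n × ℕ) :=
    fun j j' s r => {(j, r), (j', (r + s) % t)}
  let F : Fin n × Fin n × (Bool ⊕ Fin n × Fin t) → Finset (Fin n × ℕ) → ℝ := fun e ω =>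
    match e with
    | (k, j, .inl true) =>
        Real.exp (-1 * #{r ∈ range (τ (k + 1)) | {(j, r)} ⊆ ω} + lo (k + 1))
    | (k, j, .inl false) =>
        Real.exp (1 * #{r ∈ range (a (k + 1)) | {(j, r)} ⊆ ω} + -hi (k + 1))
    | (k, j, .inr (j', s)) =>
        if j' = j then 0 else
          Real.exp (1 * #{r ∈ S (k + 1) | P j j' s r ⊆ ω} + -mid (k + 1))
  have hF : ∀ e ω, 0 ≤ F e ω := by
    rintro ⟨k, j, (_ | _) | ⟨j', s⟩⟩ ω <;> simp only [F]
    · positivity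
    · positivity
    · split_ifs <;> positivity
  have he1 : Real.exp 1 - 1 ≤ 2 := by linarith [Real.exp_one_lt_d9]
  have he2 : Real.exp (-1) - 1 ≤ -(1 / 2) := by
    have : Real.exp (-1) ≤ 2⁻¹ := by
      rw [Real.exp_neg]
      exact inv_anti₀ (by norm_num) (by linarith [Real.exp_one_gt_d9])
    linarith
  have hsing : ∀ (j : Fin n) (b : ℕ),
      ((range b : Finset ℕ) : Set ℕ).PairwiseDisjoint fun r => ({(j, r)} : Finset (Fin n × ℕ)) := by
    intro j b r _ s _ hrs
    simp [Function.onFun, hrs]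
  have hq : ∀ e, ∑ ω ∈ U.powerset, bernoulliWeight U p ω * F e ω ≤ Real.exp (-Q) := by
    rintro ⟨k, j, (_ | _) | ⟨j', s⟩⟩
    all_goals
      have hk : (k : ℕ) + 1 ∈ Icc 1 n := mem_Icc.2 ⟨by omega, k.2⟩
      simp only [F]
    · refine (sum_bernoulliWeight_exp_le h0 h1 _ _ (fun r hr => ?_) (hsing j _)).trans ?_
      · have := (mem_range.1 hr).trans_le ((haτ _ hk).trans (hτ _ hk))
        simpa [U] using this
      · rw [Real.exp_le_exp]
        simp only [prod_singleton, p]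
        have hs : 0 ≤ ∑ r ∈ range (a (k + 1)), density A r :=
          sum_nonneg fun r _ => density_nonneg hA r
        nlinarith [hhi _ hk]
    · refine (sum_bernoulliWeight_exp_le h0 h1 _ _ (fun r hr => ?_) (hsing j _)).trans ?_
      · have := (mem_range.1 hr).trans_le (hτ _ hk)
        simpa [U] using this
      · rw [Real.exp_le_exp]
        simp only [prod_singleton, p]
        have hs : 0 ≤ ∑ r ∈ range (τ (k + 1)), density A r :=
          sum_nonneg fun r _ => density_nonneg hA r
        nlinarith [hlo _ hk]
    · by_cases hj : j' = j
      · simp [hj, Real.exp_nonneg]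
      simp only [hj, if_false]
      have ht : 0 < t := s.pos
      have hinj : Set.InjOn (fun r => (r + (s : ℕ)) % t) (S (k + 1)) := by
        intro r hr r' hr' h
        have h1 : r < t := (mem_filter.1 hr).2
        have h2 : r' < t := (mem_filter.1 hr').2
        have h3 : r ≡ r' [MOD t] := Nat.ModEq.add_right_cancel' _ h
        exact h3.eq_of_lt_of_lt h1 h2
      have hne : ∀ x y : ℕ, (j, x) ≠ (j', y) := fun x y h => hj (Prod.ext_iff.1 h).1.symm
      refine (sum_bernoulliWeight_exp_le h0 h1 _ _ (fun r hr => ?_) ?_).trans ?_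
      · have h1 : r < t := (mem_filter.1 hr).2
        have h2 := Nat.mod_lt (r + s) ht
        simp [P, U, insert_subset_iff, h1, h2]
      · intro r hr r' hr' hrr
        have := fun h => hrr (hinj hr hr' h)
        simp only at this
        simp [Function.onFun, P, hrr.symm, hj, Ne.symm hj, Ne.symm this]
      · rw [Real.exp_le_exp]
        have hprod : ∀ r ∈ S (k + 1), ∏ i ∈ P j j' s r, p i =
            density A r * density A ((r + s) % t) := fun r _ => prod_pair (hne _ _)
        rw [sum_congr rfl hprod]
        have hb := sum_density_mul_density_le hA (ha _ hk) ((haτ _ hk).trans (Nat.le_succ _))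
          (filter_subset _ _) hinj
        have hs : 0 ≤ ∑ r ∈ S (k + 1), density A r * density A ((r + s) % t) :=
          sum_nonneg fun r _ => mul_nonneg (density_nonneg hA r) (density_nonneg hA _)
        have := hmid _ hk
        simp only [Nat.succ_eq_add_one] at hb
        nlinarith
  obtain ⟨ω, hωU, hω⟩ := exists_subset_forall_lt_one h0 h1 F hF (Real.exp (-Q)) hq (by
    simpa using hQ)
  refine ⟨fun j r => decide ((j, r) ∈ ω), fun j r hr => ?_, fun k hk j => ?_⟩
  · rw [decide_eq_false_iff_not]
    intro h
    have := hωU h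
    simp [U] at this
    omega
  obtain ⟨hk1, hkn⟩ := mem_Icc.1 hk
  obtain ⟨k, rfl⟩ : ∃ k', k = k' + 1 := ⟨k - 1, by omega⟩
  refine ⟨?_, ?_, fun j' hj s hs => ?_⟩
  · have := hω (⟨k, hkn⟩, j, .inl true)
    simp only [F, Real.exp_lt_one_iff, singleton_subset_iff] at this
    simp only [decide_eq_true_eq]
    linarith
  · have := hω (⟨k, hkn⟩, j, .inl false)
    simp only [F, Real.exp_lt_one_iff, singleton_subset_iff] at this
    simp only [decide_eq_true_eq]
    linarith
  · have := hω (⟨k, hkn⟩, j, .inr (j', ⟨s, hs⟩))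
    simp only [F, hj, if_false, Real.exp_lt_one_iff, P, insert_subset_iff,
      singleton_subset_iff] at this
    simp only [decide_eq_true_eq]
    linarith

lemma exists_columns_of_large {n t : ℕ} {N α : ℝ} (hα : 0 < α) (hα1 : α ≤ 1)
    (hN : 4096 ≤ α ^ 2 * N) (τ : ℕ → ℕ) (hτ : ∀ k, τ k = ⌈N * (k : ℝ) ^ 2⌉₊) (ht : t = τ n)
    (hQ : (n * (n * (2 + n * t)) : ℝ) *
      Real.exp (-(α ^ 2 * N / (110592 * (1 - Real.log α)))) < 1) :
    ∃ (M : Fin n → ℕ → Bool) (a : ℕ → ℕ) (w : ℝ), 0 < w ∧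
      (∀ j r, t ≤ r → M j r = false) ∧ ∀ k ∈ Icc 1 n, ∀ j,
      w * k / 4 < #{r ∈ range (τ k) | M j r = true} ∧
      #{r ∈ range (a k) | M j r = true} < α * w * k / 8 ∧
      ∀ j' ≠ j, ∀ s < t,
        #{r ∈ {r ∈ Ico (a k) (τ k + 1) | r < t} | M j r = true ∧ M j' ((r + s) % t) = true}
          < α * w / 24 := by
  set L : ℝ := 1 - Real.log α with hL
  have hL1 : 1 ≤ L := by linarith [Real.log_nonpos hα.le hα1]
  have hα2 : α ^ 2 ≤ 1 := pow_le_one₀ hα.le hα1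
  have hNpos : 0 < N := pos_of_mul_pos_right (by linarith) (sq_nonneg α)
  have hN0 : 4096 ≤ N := by nlinarith
  have hsN : 0 < √N := Real.sqrt_pos.2 (by linarith)
  have hsq : √N * √N = N := Real.mul_self_sqrt (by linarith)
  set A : ℝ := α * √N / (2304 * L) with hAdef
  have hA : 0 < A := by positivity
  have hw : A * √N * α / 48 = α ^ 2 * N / (110592 * L) := by
    rw [hAdef]; field_simp; rw [pow_two, hsq]; ring
  have hτlow : ∀ k, √N * k ≤ √(τ k : ℝ) := by
    intro k
    rw [hτ]
    refine Real.le_sqrt_of_sq_le ?_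
    rw [mul_pow, pow_two √N, hsq]
    exact Nat.le_ceil _
  have hfl : ∀ k : ℕ, 1 ≤ k → 4096 ≤ α ^ 2 * N * (k : ℝ) ^ 2 ∧ 4096 ≤ N * (k : ℝ) ^ 2 := by
    intro k hk
    have : (1 : ℝ) ≤ (k : ℝ) ^ 2 := one_le_pow₀ (by exact_mod_cast hk)
    constructor <;> nlinarith
  refine Exists.elim (exists_columns (n := n) (t := t) hA.le τ
    (fun k => ⌊α ^ 2 * N * (k : ℝ) ^ 2 / 4096⌋₊)
    (fun k => A * √N * k / 4) (fun k => α * (A * √N) * k / 8) (fun _ => α * (A * √N) / 24)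
    (α ^ 2 * N / (110592 * L)) ?_ ?_ ?_ ?_ ?_ ?_ hQ)
    fun M hM => ⟨M, _, A * √N, by positivity, hM.1, hM.2⟩
  all_goals
    intro k hk
    obtain ⟨hk1, hkn⟩ := mem_Icc.1 hk
    have hk1' : (1 : ℝ) ≤ k := by exact_mod_cast hk1
    obtain ⟨hf1, hf2⟩ := hfl k hk1
  · rw [ht, hτ, hτ]
    gcongr
  · exact Nat.floor_pos.2 (by linarith)
  · rw [hτ]
    refine (Nat.floor_le_ceil _).trans (Nat.ceil_mono ?_)
    nlinarith [show 0 ≤ N * (k : ℝ) ^ 2 by positivity]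
  · rw [← hw]
    have h1 : A ≤ √(τ k : ℝ) := by
      refine le_trans ?_ (hτlow k)
      rw [hAdef, div_le_iff₀ (by positivity)]
      have : α ≤ k * (2304 * L) := by nlinarith
      nlinarith
    have h2 := le_sum_range_density hA.le h1
    have h3 : A * (√N * k) ≤ A * √(τ k : ℝ) := by gcongr; exact hτlow k
    have hw0 : 0 < A * √N := by positivity
    have h4 : A * √N * α ≤ A * √N * k := by gcongr; linarith
    nlinarith
  · rw [← hw]
    have h1 := sum_range_density_le hA.le ⌊α ^ 2 * N * (k : ℝ) ^ 2 / 4096⌋₊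
    have h2 : √(⌊α ^ 2 * N * (k : ℝ) ^ 2 / 4096⌋₊ : ℝ) ≤ α * √N * k / 64 := by
      refine Real.sqrt_le_left (by positivity) |>.2 ?_
      refine (Nat.floor_le (by positivity)).trans_eq ?_
      rw [div_pow, mul_pow, mul_pow, pow_two √N, hsq]; norm_num
    have h3 : 2 * A * √(⌊α ^ 2 * N * (k : ℝ) ^ 2 / 4096⌋₊ : ℝ) ≤ 2 * A * (α * √N * k / 64) := by
      gcongr
    have hw0 : 0 < A * √N * α := by positivity
    nlinarith
  · have hfloor : α ^ 2 * N * (k : ℝ) ^ 2 / 8192 ≤ (⌊α ^ 2 * N * (k : ℝ) ^ 2 / 4096⌋₊ : ℝ) := by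
      have := Nat.sub_one_lt_floor (α ^ 2 * N * (k : ℝ) ^ 2 / 4096)
      rcases le_or_gt 8192 (α ^ 2 * N * (k : ℝ) ^ 2) with h | h
      · linarith
      · have : 1 ≤ ⌊α ^ 2 * N * (k : ℝ) ^ 2 / 4096⌋₊ := Nat.floor_pos.2 (by linarith)
        have : (1 : ℝ) ≤ (⌊α ^ 2 * N * (k : ℝ) ^ 2 / 4096⌋₊ : ℝ) := by exact_mod_cast this
        linarith
    have hceil : ((τ k + 1 : ℕ) : ℝ) ≤ 3 * (N * (k : ℝ) ^ 2) := by
      have := Nat.ceil_lt_add_one (show 0 ≤ N * (k : ℝ) ^ 2 by linarith)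
      rw [hτ]; push_cast; linarith
    have hlog : Real.log ((τ k + 1 : ℕ) / (⌊α ^ 2 * N * (k : ℝ) ^ 2 / 4096⌋₊ : ℝ)) ≤
        9 + 2 * L := by
      have hpos : 0 < (⌊α ^ 2 * N * (k : ℝ) ^ 2 / 4096⌋₊ : ℝ) := by linarith
      have h1 : ((τ k + 1 : ℕ) : ℝ) / (⌊α ^ 2 * N * (k : ℝ) ^ 2 / 4096⌋₊ : ℝ) ≤ 2 ^ 15 / α ^ 2 := by
        rw [div_le_div_iff₀ hpos (by positivity)]
        nlinarith [sq_nonneg α]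
      refine (Real.log_le_log (by positivity) h1).trans ?_
      rw [Real.log_div (by norm_num) (by positivity), Real.log_pow, Real.log_pow]
      push_cast
      linarith [Real.log_two_lt_d9]
    rw [← hw]
    have h2 : A ^ 2 * (2 * (2 * Real.log ((τ k + 1 : ℕ) /
        (⌊α ^ 2 * N * (k : ℝ) ^ 2 / 4096⌋₊ : ℝ)) + 2)) ≤ A ^ 2 * (48 * L) :=
      mul_le_mul_of_nonneg_left (by linarith) (sq_nonneg A)
    have h3 : A ^ 2 * (48 * L) = A * √N * α / 48 := by
      rw [hAdef]; field_simp; norm_num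
    linarith

lemma log_bound {ε x y C : ℝ} (hε : 0 < ε) (hx : 0 ≤ x) (hy : 1 / 2 ≤ y) {q : ℝ}
    (hq : q = 110592 * (2 + 4 / ε ^ 2) * (30 + 2 * ε)) (hC : C = q ^ 2) :
    2 + Real.log C + (2 + ε) * x + 6 * y <
      C * Real.exp (ε * x) * y / (110592 * (1 + x)) := by
  have hK : 2 ≤ 2 + 4 / ε ^ 2 := by linarith [show 0 ≤ 4 / ε ^ 2 by positivity]
  set K := 2 + 4 / ε ^ 2 with hKdef
  have hq1 : 1 ≤ q := by rw [hq]; nlinarith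
  have h1 : (1 + x) ^ 2 ≤ K * Real.exp (ε * x) := by
    have e1 := Real.quadratic_le_exp_of_nonneg (show 0 ≤ ε * x by positivity)
    have e2 : K * (1 + ε * x + (ε * x) ^ 2 / 2) ≤ K * Real.exp (ε * x) := by gcongr
    have e3 : 4 / ε ^ 2 * ((ε * x) ^ 2 / 2) = 2 * x ^ 2 := by field_simp; ring
    have e4 : 0 ≤ ε * x := by positivity
    have e5 : 0 ≤ 4 / ε ^ 2 := by positivity
    nlinarith [sq_nonneg (x - 1), mul_nonneg e5 e4, sq_nonneg (ε * x)]
  have h2 : q * (30 + 2 * ε) * (1 + x) * y ≤ C * Real.exp (ε * x) * y / (110592 * (1 + x)) := by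
    rw [le_div_iff₀ (by positivity), hC]
    have : q ^ 2 = q * (30 + 2 * ε) * 110592 * K := by rw [pow_two]; nth_rw 2 [hq]; ring
    rw [this]
    have := mul_le_mul_of_nonneg_left h1
      (show 0 ≤ q * (30 + 2 * ε) * 110592 * y by positivity)
    linarith
  refine lt_of_lt_of_le ?_ h2
  have h3 : Real.log C ≤ 2 * q := by
    rw [hC, Real.log_pow]; push_cast
    linarith [Real.log_le_self (show 0 ≤ q by linarith)]
  have hxy : 0 ≤ x * y := by positivity
  have hy2 : x ≤ 2 * (x * y) := by nlinarith
  have hz : 1 / 2 ≤ (1 + x) * y := by nlinarith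
  have h4 : 2 + Real.log C + (2 + ε) * x + 6 * y ≤ (14 + 2 * ε + 4 * q) * ((1 + x) * y) := by
    nlinarith [mul_nonneg hε.le hxy]
  have h5 : (14 + 2 * ε + 4 * q) < q * (30 + 2 * ε) := by nlinarith
  have h6 := mul_lt_mul_of_pos_right h5 (show 0 < (1 + x) * y by linarith)
  linarith

lemma toNat_emod_add (t r : ℕ) (ht : 0 < t) (i : ℤ) :
    (((r : ℤ) + i) % (t : ℤ)).toNat = (r + (i % (t : ℤ)).toNat) % t := by
  have ht' : (t : ℤ) ≠ 0 := by exact_mod_cast ht.ne'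
  have h1 := Int.emod_nonneg i ht'
  have h2 := Int.emod_nonneg ((r : ℤ) + i) ht'
  zify
  rw [Int.toNat_of_nonneg h1, Int.toNat_of_nonneg h2, Int.add_emod_emod]

lemma exists_shift_of_slip {t n : ℕ} {M : Fin n → ℕ → Bool} {T : Finset (Fin n)}
    {z : ℕ → Bool} (ht : 0 < t) {σ : Fin n → ℤ}
    (hz : ∀ r : ℕ, z r = true ↔ ∃ j ∈ T, cshift t (M j) (σ j) r = true) {r : ℕ}
    (hr : slip t z r = true) :
    ∃ j ∈ T, ∃ d ∈ ({-1, 0, 1} : Finset ℤ),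
      M j ((r + ((σ j + d) % (t : ℤ)).toNat) % t) = true := by
  have ht' : (t : ℤ) ≠ 0 := by exact_mod_cast ht.ne'
  have key : ∀ d : ℤ, cshift t z d r = true →
      ∃ j ∈ T, M j ((r + ((σ j + d) % (t : ℤ)).toNat) % t) = true := by
    intro d hd
    obtain ⟨j, hj, h⟩ := (hz _).1 hd
    refine ⟨j, hj, ?_⟩
    unfold cshift at h
    rw [Int.toNat_of_nonneg (Int.emod_nonneg _ ht'), Int.emod_add_emod, add_assoc,
      toNat_emod_add _ _ ht, add_comm d] at h
    exact h
  simp only [slip, Bool.or_eq_true] at hr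
  rcases hr with (h | h) | h
  · obtain ⟨j, hj, h⟩ := key _ h
    exact ⟨j, hj, -1, by simp, h⟩
  · obtain ⟨j, hj, h⟩ := (hz _).1 h
    refine ⟨j, hj, 0, by simp, ?_⟩
    unfold cshift at h
    rwa [toNat_emod_add _ _ ht, ← add_zero (σ j)] at h
  · obtain ⟨j, hj, h⟩ := key _ h
    exact ⟨j, hj, 1, by simp, h⟩

lemma wt_vand_slip_le {t n a τ : ℕ} {M : Fin n → ℕ → Bool} {T : Finset (Fin n)} {j : Fin n}
    {z : ℕ → Bool} {m : ℝ} (ht : 0 < t) (h0 : ∀ j r, t ≤ r → M j r = false)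
    (hz : memSupShift t M T z)
    (hm : ∀ j' ∈ T, ∀ s < t,
      #{r ∈ {r ∈ Ico a (τ + 1) | r < t} | M j r = true ∧ M j' ((r + s) % t) = true} < m) :
    (wt (vand (M j) (slip t z)) 0 τ : ℝ) ≤
      #{r ∈ range a | M j r = true} + 3 * #T * m := by
  obtain ⟨σ, hσ⟩ := hz
  let s : Fin n → ℤ → ℕ := fun j' d => ((σ j' + d) % (t : ℤ)).toNat
  have hs : ∀ j' d, s j' d < t := fun j' d => by
    have := Int.emod_lt_of_pos (σ j' + d) (show (0 : ℤ) < t by exact_mod_cast ht)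
    simp only [s]; omega
  let B : Fin n × ℤ → Finset ℕ := fun e =>
    {r ∈ {r ∈ Ico a (τ + 1) | r < t} | M j r = true ∧ M e.1 ((r + s e.1 e.2) % t) = true}
  have hsub : ((Icc 0 τ).filter fun r => vand (M j) (slip t z) r = true) ⊆
      {r ∈ range a | M j r = true} ∪ (T ×ˢ ({-1, 0, 1} : Finset ℤ)).biUnion B := by
    intro r hr
    obtain ⟨hrτ, hr⟩ := mem_filter.1 hr
    simp only [vand, Bool.and_eq_true] at hr
    have hrt : r < t := by
      by_contra! h
      simp [h0 j r h] at hr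
    rw [mem_union]
    rcases lt_or_ge r a with h | h
    · exact Or.inl (mem_filter.2 ⟨mem_range.2 h, hr.1⟩)
    · obtain ⟨j', hj', d, hd, hM⟩ := exists_shift_of_slip ht hσ hr.2
      refine Or.inr (mem_biUnion.2 ⟨(j', d), mem_product.2 ⟨hj', hd⟩, ?_⟩)
      have := (mem_Icc.1 hrτ).2
      exact mem_filter.2 ⟨mem_filter.2 ⟨mem_Ico.2 ⟨h, by omega⟩, hrt⟩, hr.1, hM⟩
  have hcard : wt (vand (M j) (slip t z)) 0 τ ≤ #{r ∈ range a | M j r = true} +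
      ∑ e ∈ T ×ˢ ({-1, 0, 1} : Finset ℤ), #(B e) :=
    (card_le_card hsub).trans ((card_union_le _ _).trans (by gcongr; exact card_biUnion_le))
  have hsum : ((∑ e ∈ T ×ˢ ({-1, 0, 1} : Finset ℤ), #(B e) : ℕ) : ℝ) ≤ 3 * #T * m := by
    push_cast
    refine (sum_le_card_nsmul _ _ m fun e he => ?_).trans_eq ?_
    · exact (hm e.1 (mem_product.1 he).1 _ (hs _ _)).le
    · rw [card_product, nsmul_eq_mul]
      push_cast
      rw [show #({-1, 0, 1} : Finset ℤ) = 3 by decide]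
      push_cast; ring
  calc (wt (vand (M j) (slip t z)) 0 τ : ℝ)
      ≤ ((#{r ∈ range a | M j r = true} +
          ∑ e ∈ T ×ˢ ({-1, 0, 1} : Finset ℤ), #(B e) : ℕ) : ℝ) := by exact_mod_cast hcard
    _ ≤ _ := by rw [Nat.cast_add]; gcongr

lemma card_mul_exp_lt_one {n t : ℕ} {N Y : ℝ} (hn : 2 ≤ n) (hN : 1 ≤ N)
    (ht : t = ⌈N * (n : ℝ) ^ 2⌉₊) (hY : 2 + Real.log N + 5 * Real.log n < Y) :
    (n * (n * (2 + n * t)) : ℝ) * Real.exp (-Y) < 1 := by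
  have hn' : (2 : ℝ) ≤ n := by exact_mod_cast hn
  have hNn : 1 ≤ N * (n : ℝ) ^ 2 := by nlinarith
  have h1 : (t : ℝ) ≤ 2 * N * (n : ℝ) ^ 2 := by
    have := Nat.ceil_lt_add_one (show 0 ≤ N * (n : ℝ) ^ 2 by positivity)
    rw [ht]; linarith
  have ht1 : (1 : ℝ) ≤ t := by rw [ht]; exact hNn.trans (Nat.le_ceil _)
  have h2 : (n * (n * (2 + n * t)) : ℝ) ≤ 4 * N * (n : ℝ) ^ 5 :=
    calc (n * (n * (2 + n * t)) : ℝ) ≤ n * (n * (n * t + n * t)) := by gcongr; nlinarith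
      _ = 2 * (n : ℝ) ^ 3 * t := by ring
      _ ≤ 2 * (n : ℝ) ^ 3 * (2 * N * (n : ℝ) ^ 2) := by gcongr
      _ = _ := by ring
  have h3 : 4 * N * (n : ℝ) ^ 5 < Real.exp Y := by
    rw [← Real.log_lt_iff_lt_exp (by positivity), Real.log_mul (by positivity) (by positivity),
      Real.log_mul (by norm_num) (by positivity), Real.log_pow,
      show (4 : ℝ) = 2 ^ 2 by norm_num, Real.log_pow]
    push_cast
    linarith [Real.log_two_lt_d9]
  rw [Real.exp_neg, mul_inv_lt_iff₀ (Real.exp_pos _)]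
  linarith

/-- Existence of `(n, α)`-ultra-resilient superimposed codes with
`t = ⌈(C/α^{2+ε})·n²·ln n⌉` rows and elongation `τ(n,k) = ⌈(C/α^{2+ε})·k²·ln n⌉`:
for every `ε > 0` there is a constant `C > 0` such that for every `n ≥ 2` and every
`α ∈ (0,1]` there is a `t × n` binary matrix `M` such that for every `2 ≤ k ≤ n` with
`e^{−k} < α`, every subset `T` of `k` column indices, every `c_j ∈ T` and every
`z ∈ S∨(T∖{c_j})` we have `|([c_j] ∧ z*)_{[0,τ(n,k)]}| < α·|[c_j]_{[0,τ(n,k)]}|`. -/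
theorem stmt16 (ε : ℝ) (hε : 0 < ε) :
    ∃ C : ℝ, 0 < C ∧
      ∀ n : ℕ, 2 ≤ n → ∀ α : ℝ, 0 < α → α ≤ 1 →
        ∃ M : Fin n → ℕ → Bool,
          ∀ k : ℕ, 2 ≤ k → k ≤ n → Real.exp (-(k : ℝ)) < α →
            ∀ T : Finset (Fin n), T.card = k → ∀ cj ∈ T,
              ∀ z : ℕ → Bool,
                memSupShift ⌈C / α ^ ((2 : ℝ) + ε) * (n : ℝ) ^ 2 * Real.log n⌉₊
                  M (T.erase cj) z →
                (wt (vand (M cj)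
                      (slip ⌈C / α ^ ((2 : ℝ) + ε) * (n : ℝ) ^ 2 * Real.log n⌉₊ z))
                    0 ⌈C / α ^ ((2 : ℝ) + ε) * (k : ℝ) ^ 2 * Real.log n⌉₊ : ℝ)
                  < α * (wt (M cj)
                      0 ⌈C / α ^ ((2 : ℝ) + ε) * (k : ℝ) ^ 2 * Real.log n⌉₊ : ℝ) := by
  set q : ℝ := 110592 * (2 + 4 / ε ^ 2) * (30 + 2 * ε) with hq
  have hq1 : 110592 ≤ q := by
    have : 0 ≤ 4 / ε ^ 2 := by positivity
    nlinarith [mul_nonneg this hε.le]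
  refine ⟨q ^ 2, by positivity, fun n hn α hα hα1 => ?_⟩
  set C : ℝ := q ^ 2 with hC
  have hC0 : 10000 ≤ C := by nlinarith
  set N : ℝ := C / α ^ ((2 : ℝ) + ε) * Real.log n with hNdef
  have hform : ∀ k : ℕ, C / α ^ ((2 : ℝ) + ε) * (k : ℝ) ^ 2 * Real.log n = N * (k : ℝ) ^ 2 :=
    fun k => by rw [hNdef]; ring
  simp only [hform]
  have hn' : (2 : ℝ) ≤ n := by exact_mod_cast hn
  have hlogn : 1 / 2 ≤ Real.log n := by
    have := Real.log_le_log (by norm_num) hn'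
    linarith [Real.log_two_gt_d9]
  have hlogα : 0 ≤ -Real.log α := by linarith [Real.log_nonpos hα.le hα1]
  have hpow : α ^ ((2 : ℝ) + ε) = α ^ 2 * (Real.exp (ε * -Real.log α))⁻¹ := by
    rw [Real.rpow_add hα, ← Real.exp_neg, Real.rpow_def_of_pos hα ε, Real.rpow_two]
    congr 2; ring
  have hαN : α ^ 2 * N = C * Real.exp (ε * -Real.log α) * Real.log n := by
    rw [hNdef, hpow]; field_simp
  have hexp1 : 1 ≤ Real.exp (ε * -Real.log α) := Real.one_le_exp (by positivity)
  have hlarge : 4096 ≤ α ^ 2 * N := by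
    have : C * 1 * (1 / 2) ≤ C * Real.exp (ε * -Real.log α) * Real.log n := by gcongr
    linarith
  have hN1 : 1 ≤ N := by
    have hα2 : α ^ 2 ≤ 1 := pow_le_one₀ hα.le hα1
    have : 0 < N := pos_of_mul_pos_right (by linarith) (sq_nonneg α)
    nlinarith
  have hlogN : Real.log N ≤ Real.log C + (2 + ε) * -Real.log α + Real.log n := by
    have hp : 0 < α ^ ((2 : ℝ) + ε) := by positivity
    rw [hNdef, Real.log_mul (by positivity) (by positivity), Real.log_div (by positivity) hp.ne',
      Real.log_rpow hα]
    have := Real.log_le_self (show 0 ≤ Real.log n by linarith)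
    linarith
  have hY := log_bound hε hlogα hlogn hq hC
  have hcard := card_mul_exp_lt_one (N := N) (Y := α ^ 2 * N / (110592 * (1 - Real.log α))) hn hN1
    rfl (by rw [hαN, sub_eq_add_neg]; linarith)
  obtain ⟨M, a, w, hw, h0, hM⟩ := exists_columns_of_large hα hα1 hlarge
    (fun k => ⌈N * (k : ℝ) ^ 2⌉₊) (fun _ => rfl) rfl hcard
  have ht : 0 < ⌈N * (n : ℝ) ^ 2⌉₊ := Nat.ceil_pos.2 (by positivity)
  refine ⟨M, fun k hk2 hkn _ T hT cj hcj z hz => ?_⟩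
  obtain ⟨hlo, hhi, hmid⟩ := hM k (mem_Icc.2 ⟨by omega, hkn⟩) cj
  have hle := wt_vand_slip_le (a := a k) (τ := ⌈N * (k : ℝ) ^ 2⌉₊) (j := cj) ht h0 hz
    fun j' hj' s hs => hmid j' (ne_of_mem_erase hj') s hs
  have hcardT : (#(T.erase cj) : ℝ) ≤ k := by
    rw [← hT]; exact_mod_cast card_erase_le
  have hwt : (#{r ∈ range ⌈N * (k : ℝ) ^ 2⌉₊ | M cj r = true} : ℝ) ≤
      wt (M cj) 0 ⌈N * (k : ℝ) ^ 2⌉₊ := by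
    unfold wt
    gcongr
    intro r hr
    rw [mem_range] at hr
    exact mem_Icc.2 ⟨r.zero_le, hr.le⟩
  have h1 : 3 * (#(T.erase cj) : ℝ) * (α * w / 24) ≤ 3 * k * (α * w / 24) := by gcongr
  have h2 : α * (w * k / 4) < α * wt (M cj) 0 ⌈N * (k : ℝ) ^ 2⌉₊ := by
    gcongr; exact hlo.trans_le hwt
  linarith
end
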